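/- Let (x*, λ*) be a primal-dual solution of the cone-constrained problem. Then the following convergence rates of order o(1/k) hold as k → +∞: k·‖x_k − x_{k−1}‖ → 0, k·‖λ_k − λ_{k−1}‖ → 0, k·‖u_k + ∇h(x_k) + A*λ_k‖ → 0, k·‖v_k − Ax_k + b‖ → 0, k·(L(x_k, λ*) − L(x*, λ_k)) → 0, k·|⟨λ_k, Ax_k − b⟩| → 0, and k·|f(x_k) + h(x_k) − f(x*) − h(x*)| → 0. -/

import Mathlib

open scoped RealInnerProductSpace Pointwise
open Filter

/-- Discrete Lyapunov energy at time `t`, with displacement `d` from a solution, increment `D`,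
operator value `ξ`, operator increment `δ` and approximation error `e`. -/
noncomputable def fastEnergy {H : Type*} [NormedAddCommGroup H] [InnerProductSpace ℝ H]
    (α l t : ℝ) (d D ξ δ e : H) : ℝ :=
  2 * l * ((α - 1) * ‖d‖ ^ 2 + 2 * ⟪d, t • D + t • ξ⟫) +
    (‖t • D‖ ^ 2 + ‖t • D + t • ξ‖ ^ 2 + 2 * ⟪t • D, t • e⟫ + t ^ 2 / 2 * ‖δ‖ ^ 2)

section Energy

variable {H : Type*} [NormedAddCommGroup H] [InnerProductSpace ℝ H]

theorem fastEnergy_sub (α c l t : ℝ) (d D ξ δ e D' δ' e' : H)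
    (hD' : t • D' = (t + α) • D + (t + α - c) • δ + c • ξ) :
    fastEnergy α l (t + 1) d D ξ δ e - fastEnergy α l t (d - D) D' (ξ - δ) δ' e'
      + 2 * (t + 1) ^ 2 * ⟪D, δ - e + e'⟫ + 4 * l * (c - 1) * ⟪d, ξ - e⟫ =
    (-4 * (α - 1 - l) * t + (2 * l * (α + 1) + 2 - 2 * α ^ 2)) * ‖D‖ ^ 2
      + (4 * (l + 1 - c - α / 2) * t + (4 * l * c - 4 * α * c + 2)) * ⟪D, ξ⟫
      + (-2 * (c - 1) * t + (1 - 2 * c ^ 2)) * ‖ξ‖ ^ 2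
      + ((-6 * α + 4 * c + 4) * t + (4 * (l - α) * (α - c) + 2)) * ⟪D, δ⟫
      + (-2 * α * t + (-4 * c * (α - c))) * ⟪ξ, δ⟫
      + (-(t ^ 2) / 2 + ((1 - 2 * (α - c)) * t + (1 / 2 - 2 * (α - c) ^ 2))) * ‖δ‖ ^ 2
      - t ^ 2 / 2 * ‖δ'‖ ^ 2
      + ((4 - 2 * α) * t + 2) * ⟪D, e'⟫
      + (-2 * t ^ 2 + (-2 * (α - c) * t + 0)) * ⟪δ, e'⟫
      + (-2 * c * t + 0) * ⟪ξ, e'⟫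
      + (0 * t + -4 * l * (α - c)) * ⟪d, δ⟫ + (0 * t + -4 * l * (c - 1)) * ⟪d, e⟫ := by
  unfold fastEnergy
  rw [hD']
  simp only [← real_inner_self_eq_norm_sq, inner_add_left, inner_add_right, inner_sub_left,
    inner_sub_right, real_inner_smul_left, real_inner_smul_right]
  rw [real_inner_comm d D, real_inner_comm ξ D, real_inner_comm δ D, real_inner_comm ξ δ]
  ring

theorem fastEnergy_eq (α l t : ℝ) (d D ξ δ e : H) :
    fastEnergy α l t d D ξ δ e =
      ‖t • D + l • d + t • e‖ ^ 2 + ‖t • D + t • (ξ - e) + l • d + t • e‖ ^ 2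
      + t ^ 2 * (1 / 2 * ‖δ‖ ^ 2 - ‖e‖ ^ 2) + 2 * l * (α - 1 - l) * ‖d‖ ^ 2
      + 2 * l * (t * ⟪d, ξ - e⟫) := by
  unfold fastEnergy
  simp only [← real_inner_self_eq_norm_sq, inner_add_left, inner_add_right, inner_sub_left,
    inner_sub_right, real_inner_smul_left, real_inner_smul_right]
  rw [real_inner_comm d D, real_inner_comm ξ D, real_inner_comm d ξ, real_inner_comm d e,
    real_inner_comm e D, real_inner_comm e ξ]
  ring

end Energy

theorem abs_affine_le {A B C t : ℝ} (ht : 1 ≤ t) (hC : |A| + |B| ≤ C) : |A * t + B| ≤ C * t := by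
  calc |A * t + B| ≤ |A * t| + |B| := abs_add_le _ _
    _ = |A| * t + |B| := by rw [abs_mul, abs_of_nonneg (by linarith : (0 : ℝ) ≤ t)]
    _ ≤ |A| * t + |B| * t := by nlinarith [abs_nonneg B]
    _ ≤ C * t := by nlinarith

theorem affine_mul_le {A B C t r m : ℝ} (ht : 1 ≤ t) (hC : |A| + |B| ≤ C) (hr : |r| ≤ m) :
    (A * t + B) * r ≤ C * t * m := by
  refine (le_abs_self _).trans ?_
  rw [abs_mul]
  exact mul_le_mul (abs_affine_le ht hC) hr (abs_nonneg _)
    ((abs_nonneg _).trans (abs_affine_le ht hC))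

theorem posDef_form_le {s p m : ℝ} (hs : 0 < s) (hp : 0 < p) (hm : m ^ 2 < 2 * s * p) :
    ∃ ε > 0, ∀ a x r : ℝ, |r| ≤ a * x →
      -4 * s * a ^ 2 + 4 * m * r - 2 * p * x ^ 2 ≤ -ε * (a ^ 2 + x ^ 2) := by
  have hT : 0 < 4 * s + 2 * p := by positivity
  refine ⟨(8 * s * p - 4 * m ^ 2) / (4 * s + 2 * p), div_pos (by linarith) hT, ?_⟩
  intro a x r hr
  set ε := (8 * s * p - 4 * m ^ 2) / (4 * s + 2 * p) with hε
  have hεT : ε * (4 * s + 2 * p) = 8 * s * p - 4 * m ^ 2 := by rw [hε]; field_simp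
  have h1 : 0 < 4 * s - ε := by
    have : 0 < (4 * s - ε) * (4 * s + 2 * p) := by nlinarith [sq_nonneg m, mul_pos hs hs]
    exact pos_of_mul_pos_left this hT.le
  have h2 : m * r ≤ |m| * (a * x) := by
    refine (le_abs_self _).trans ?_
    rw [abs_mul]
    exact mul_le_mul_of_nonneg_left hr (abs_nonneg _)
  have h3 : (4 * s - ε) * (2 * p - ε) = 4 * |m| ^ 2 + ε ^ 2 := by rw [sq_abs]; linarith
  have h4 : 0 ≤ (4 * s - ε) * ((4 * s - ε) * a ^ 2 - 4 * |m| * (a * x) + (2 * p - ε) * x ^ 2) := by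
    have : (4 * s - ε) * ((4 * s - ε) * a ^ 2 - 4 * |m| * (a * x) + (2 * p - ε) * x ^ 2)
      = ((4 * s - ε) * a - 2 * |m| * x) ^ 2 + ε ^ 2 * x ^ 2 := by
        linear_combination x ^ 2 * h3
    rw [this]; positivity
  have h5 := nonneg_of_mul_nonneg_right h4 h1
  linarith

theorem young_mul_le {ω C t a n : ℝ} (hω : 0 < ω) :
    C * t * (a * n) ≤ ω / 16 * (t ^ 2 * n ^ 2) + 4 * C ^ 2 / ω * a ^ 2 := by
  have : 0 ≤ ω / 16 * (t * n - 8 * C / ω * a) ^ 2 := by positivity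
  have e : ω / 16 * (t * n - 8 * C / ω * a) ^ 2 =
      ω / 16 * (t ^ 2 * n ^ 2) + 4 * C ^ 2 / ω * a ^ 2 - C * t * (a * n) := by
    field_simp; ring
  linarith

theorem lower_order_le {ω ε C t a x n n' dd : ℝ} (hω : 0 < ω) (hC : 0 ≤ C) (ht : 0 < t)
    (ht2 : 2 * C + 8 * C ^ 2 / ω ≤ ε / 2 * t) (ht3 : C ≤ ω / 16 * t) :
    C * a ^ 2 + C * (a * x) + C * x ^ 2 + C * t * (a * n) + C * t * (x * n) + C * t * n ^ 2
      + C * t * (a * n') + C * t * (n * n') + C * t * (x * n') + C * (dd * n) + C * (dd * n)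
    ≤ ε / 2 * (t * (a ^ 2 + x ^ 2)) + ω / 2 * (t ^ 2 * n ^ 2) + ω / 2 * (t ^ 2 * n' ^ 2)
      + 16 * C ^ 2 / ω / t ^ 2 * dd ^ 2 := by
  have y4 : C * t * (a * n) ≤ _ := young_mul_le hω
  have y5 : C * t * (x * n) ≤ _ := young_mul_le hω
  have y7 : C * t * (a * n') ≤ _ := young_mul_le hω
  have y9 : C * t * (x * n') ≤ _ := young_mul_le hω
  have y2 : C * (a * x) ≤ C / 2 * a ^ 2 + C / 2 * x ^ 2 := by
    linarith [mul_nonneg hC (sq_nonneg (a - x))]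
  have y6 : C * t * n ^ 2 ≤ ω / 16 * (t ^ 2 * n ^ 2) := by
    have := mul_le_mul_of_nonneg_right ht3 (by positivity : 0 ≤ t * n ^ 2)
    linarith
  have y6' : C * t * n' ^ 2 ≤ ω / 16 * (t ^ 2 * n' ^ 2) := by
    have := mul_le_mul_of_nonneg_right ht3 (by positivity : 0 ≤ t * n' ^ 2)
    linarith
  have y8 : C * t * (n * n') ≤ C * t / 2 * n ^ 2 + C * t / 2 * n' ^ 2 := by
    linarith [mul_nonneg (mul_nonneg hC ht.le) (sq_nonneg (n - n'))]
  have y10 : C * (dd * n) ≤ ω / 16 * (t ^ 2 * n ^ 2) + 4 * C ^ 2 / ω / t ^ 2 * dd ^ 2 := by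
    have := young_mul_le (ω := ω) (C := C) (t := t) (a := dd / t) (n := n) hω
    have e1 : C * t * (dd / t * n) = C * (dd * n) := by field_simp
    have e2 : 4 * C ^ 2 / ω * (dd / t) ^ 2 = 4 * C ^ 2 / ω / t ^ 2 * dd ^ 2 := by field_simp
    linarith
  have hX := mul_le_mul_of_nonneg_right ht2 (by positivity : 0 ≤ a ^ 2 + x ^ 2)
  have hQ4 : 16 * C ^ 2 / ω / t ^ 2 * dd ^ 2 = 4 * (4 * C ^ 2 / ω / t ^ 2 * dd ^ 2) := by ring
  have hQd : 0 ≤ 4 * C ^ 2 / ω / t ^ 2 * dd ^ 2 := by positivity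
  have hQ8 : 8 * C ^ 2 / ω = 2 * (4 * C ^ 2 / ω) := by ring
  rw [hQ4]
  rw [hQ8] at hX
  generalize 4 * C ^ 2 / ω / t ^ 2 * dd ^ 2 = R at *
  generalize 4 * C ^ 2 / ω = Q at *
  have hN : 0 ≤ ω * (t ^ 2 * n ^ 2) := by positivity
  have hN' : 0 ≤ ω * (t ^ 2 * n' ^ 2) := by positivity
  have hCa : 0 ≤ C * a ^ 2 := by positivity
  have hCx : 0 ≤ C * x ^ 2 := by positivity
  linarith

section Energy

variable {H : Type*} [NormedAddCommGroup H] [InnerProductSpace ℝ H]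

set_option maxHeartbeats 1000000 in
theorem fastEnergy_succ_le_of_coeff {α c l θ ε C t : ℝ} (hl : 0 < l) (hc : 1 < c)
    (hθ0 : 0 ≤ θ) (hθ : θ < 1 / 2) (hC0 : 0 ≤ C)
    (hform : ∀ a x r : ℝ, |r| ≤ a * x →
      -4 * (α - 1 - l) * a ^ 2 + 4 * (l + 1 - c - α / 2) * r - 2 * (c - 1) * x ^ 2
        ≤ -ε * (a ^ 2 + x ^ 2))
    (h1 : |(0 : ℝ)| + |2 * l * (α + 1) + 2 - 2 * α ^ 2| ≤ C)
    (h2 : |(0 : ℝ)| + |4 * l * c - 4 * α * c + 2| ≤ C)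
    (h3 : |(0 : ℝ)| + |1 - 2 * c ^ 2| ≤ C)
    (h4 : |-6 * α + 4 * c + 4| + |4 * (l - α) * (α - c) + 2| ≤ C)
    (h5 : |-2 * α| + |-4 * c * (α - c)| ≤ C)
    (h6 : |1 - 2 * (α - c)| + |1 / 2 - 2 * (α - c) ^ 2| ≤ C)
    (h7 : |4 - 2 * α| + |(2 : ℝ)| ≤ C)
    (h8 : |-2 * (α - c)| + |(0 : ℝ)| ≤ C)
    (h9 : |-2 * c| + |(0 : ℝ)| ≤ C)
    (h10 : |(0 : ℝ)| + |-4 * l * (α - c)| ≤ C)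
    (h11 : |(0 : ℝ)| + |-4 * l * (c - 1)| ≤ C)
    (ht1 : 1 ≤ t) (ht2 : 2 * C + 8 * C ^ 2 / (1 / 2 - θ) ≤ ε / 2 * t)
    (ht3 : C ≤ (1 / 2 - θ) / 16 * t) {d D ξ δ e D' δ' e' : H}
    (hD' : t • D' = (t + α) • D + (t + α - c) • δ + c • ξ)
    (he : ‖e‖ ≤ θ * ‖δ‖) (he' : ‖e'‖ ≤ θ * ‖δ'‖) (hmon : 0 ≤ ⟪D, δ - e + e'⟫)
    (hmons : 0 ≤ ⟪d, ξ - e⟫) :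
    fastEnergy α l (t + 1) d D ξ δ e
        + (ε / 2 * (t * (‖D‖ ^ 2 + ‖ξ‖ ^ 2)) + (1 / 2 - θ) / 2 * (t ^ 2 * ‖δ‖ ^ 2))
      ≤ fastEnergy α l t (d - D) D' (ξ - δ) δ' e'
        + 16 * C ^ 2 / (1 / 2 - θ) / t ^ 2 * ‖d‖ ^ 2 := by
  have ht0 : 0 < t := by linarith
  have hid := fastEnergy_sub α c l t d D ξ δ e D' δ' e' hD'
  have hen : ‖e‖ ≤ ‖δ‖ := he.trans (by nlinarith [norm_nonneg δ])
  have hen' : ‖e'‖ ≤ ‖δ'‖ := he'.trans (by nlinarith [norm_nonneg δ'])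
  have hp1 : 0 ≤ 2 * (t + 1) ^ 2 * ⟪D, δ - e + e'⟫ := by positivity
  have hp2 : 0 ≤ 4 * l * (c - 1) * ⟪d, ξ - e⟫ := by
    have : 0 < c - 1 := by linarith
    positivity
  have cDξ : |⟪D, ξ⟫| ≤ ‖D‖ * ‖ξ‖ := abs_real_inner_le_norm _ _
  have cDe' : |⟪D, e'⟫| ≤ ‖D‖ * ‖δ'‖ :=
    (abs_real_inner_le_norm _ _).trans (mul_le_mul_of_nonneg_left hen' (norm_nonneg _))
  have cξe' : |⟪ξ, e'⟫| ≤ ‖ξ‖ * ‖δ'‖ :=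
    (abs_real_inner_le_norm _ _).trans (mul_le_mul_of_nonneg_left hen' (norm_nonneg _))
  have cδe' : |⟪δ, e'⟫| ≤ ‖δ‖ * ‖δ'‖ :=
    (abs_real_inner_le_norm _ _).trans (mul_le_mul_of_nonneg_left hen' (norm_nonneg _))
  have cde : |⟪d, e⟫| ≤ ‖d‖ * ‖δ‖ :=
    (abs_real_inner_le_norm _ _).trans (mul_le_mul_of_nonneg_left hen (norm_nonneg _))
  have cδe2 : |⟪δ, e'⟫| ≤ θ * (‖δ‖ * ‖δ'‖) :=
    (abs_real_inner_le_norm _ _).trans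
      ((mul_le_mul_of_nonneg_left he' (norm_nonneg _)).trans_eq (by ring))
  have const_le : ∀ {B r m : ℝ}, |(0 : ℝ)| + |B| ≤ C → |r| ≤ m → B * r ≤ C * m := by
    intro B r m hB hr
    have := affine_mul_le (t := 1) le_rfl hB hr
    linarith
  have sq : ∀ r : ℝ, |r ^ 2| ≤ r ^ 2 := fun r => (abs_of_nonneg (sq_nonneg r)).le
  have b1 := const_le h1 (sq ‖D‖)
  have b2 := const_le h2 cDξ
  have b3 := const_le h3 (sq ‖ξ‖)
  have b4 := affine_mul_le ht1 h4 (abs_real_inner_le_norm D δ)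
  have b5 := affine_mul_le ht1 h5 (abs_real_inner_le_norm ξ δ)
  have b6 := affine_mul_le ht1 h6 (sq ‖δ‖)
  have b7 := affine_mul_le ht1 h7 cDe'
  have b8 := affine_mul_le ht1 h8 cδe'
  have b9 := affine_mul_le ht1 h9 cξe'
  have b10 := const_le h10 (abs_real_inner_le_norm d δ)
  have b11 := const_le h11 cde
  have b12 : -2 * t ^ 2 * ⟪δ, e'⟫ ≤ θ * t ^ 2 * (‖δ‖ ^ 2 + ‖δ'‖ ^ 2) := by
    have h1 : -⟪δ, e'⟫ ≤ θ * (‖δ‖ * ‖δ'‖) := (neg_le_abs _).trans cδe2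
    have h2 := mul_le_mul_of_nonneg_left (two_mul_le_add_sq ‖δ‖ ‖δ'‖) hθ0
    have h3 : -2 * ⟪δ, e'⟫ ≤ θ * (‖δ‖ ^ 2 + ‖δ'‖ ^ 2) := by linarith
    linarith [mul_le_mul_of_nonneg_left h3 (sq_nonneg t)]
  have b0 := mul_le_mul_of_nonneg_left (hform _ _ _ cDξ) ht0.le
  have low := lower_order_le (dd := ‖d‖) (by linarith : 0 < 1 / 2 - θ) hC0 ht0 ht2 ht3
    (a := ‖D‖) (x := ‖ξ‖) (n := ‖δ‖) (n' := ‖δ'‖)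
  have hN : 0 ≤ (1 / 2 - θ) * (t ^ 2 * ‖δ'‖ ^ 2) :=
    mul_nonneg (by linarith) (by positivity)
  linear_combination hid + hp1 + hp2 + b0 + b1 + b2 + b3 + b4 + b5 + b6 + b7 + b8 + b9 + b10 +
    b11 + b12 + low + hN / 2

theorem fastEnergy_succ_le {α c l θ : ℝ} (hl : 0 < l) (hs : 0 < α - 1 - l) (hc : 1 < c)
    (hm : (l + 1 - c - α / 2) ^ 2 < 2 * (α - 1 - l) * (c - 1)) (hθ0 : 0 ≤ θ) (hθ : θ < 1 / 2) :
    ∃ ε > 0, ∃ C ≥ 0, ∃ T ≥ 1, ∀ t ≥ T, ∀ d D ξ δ e D' δ' e' : H,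
      t • D' = (t + α) • D + (t + α - c) • δ + c • ξ →
      ‖e‖ ≤ θ * ‖δ‖ → ‖e'‖ ≤ θ * ‖δ'‖ → 0 ≤ ⟪D, δ - e + e'⟫ → 0 ≤ ⟪d, ξ - e⟫ →
      fastEnergy α l (t + 1) d D ξ δ e + ε * (t * (‖D‖ ^ 2 + ‖ξ‖ ^ 2) + t ^ 2 * ‖δ‖ ^ 2)
        ≤ fastEnergy α l t (d - D) D' (ξ - δ) δ' e' + C / t ^ 2 * ‖d‖ ^ 2 := by
  obtain ⟨ε, hε, hform⟩ := posDef_form_le hs (by linarith : 0 < c - 1) hm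
  obtain ⟨C, hC0, h1, h2, h3, h4, h5, h6, h7, h8, h9, h10, h11⟩ : ∃ C : ℝ, 0 ≤ C ∧
      |(0 : ℝ)| + |2 * l * (α + 1) + 2 - 2 * α ^ 2| ≤ C ∧
      |(0 : ℝ)| + |4 * l * c - 4 * α * c + 2| ≤ C ∧
      |(0 : ℝ)| + |1 - 2 * c ^ 2| ≤ C ∧
      |-6 * α + 4 * c + 4| + |4 * (l - α) * (α - c) + 2| ≤ C ∧
      |-2 * α| + |-4 * c * (α - c)| ≤ C ∧
      |1 - 2 * (α - c)| + |1 / 2 - 2 * (α - c) ^ 2| ≤ C ∧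
      |4 - 2 * α| + |(2 : ℝ)| ≤ C ∧
      |-2 * (α - c)| + |(0 : ℝ)| ≤ C ∧
      |-2 * c| + |(0 : ℝ)| ≤ C ∧
      |(0 : ℝ)| + |-4 * l * (α - c)| ≤ C ∧
      |(0 : ℝ)| + |-4 * l * (c - 1)| ≤ C := by
    have key : ∀ r : ℝ, ∀ᶠ C in atTop, r ≤ C := fun r => eventually_ge_atTop r
    exact (((key _).and <| (key _).and <| (key _).and <| (key _).and <| (key _).and <|
      (key _).and <| (key _).and <| (key _).and <| (key _).and <| (key _).and <|
      (key _).and (key _))).exists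
  have hω : 0 < 1 / 2 - θ := by linarith
  refine ⟨min (ε / 2) ((1 / 2 - θ) / 2), lt_min (by linarith) (by linarith),
    16 * C ^ 2 / (1 / 2 - θ), by positivity,
    max 1 (max ((2 * C + 8 * C ^ 2 / (1 / 2 - θ)) / (ε / 2)) (C / ((1 / 2 - θ) / 16))),
    le_max_left _ _, ?_⟩
  intro t ht d D ξ δ e D' δ' e' hD' he he' hmon hmons
  have ht1 : 1 ≤ t := (le_max_left _ _).trans ht
  have ht2 := ((le_max_left _ _).trans (le_max_right _ _)).trans ht
  have ht3 := ((le_max_right _ _).trans (le_max_right _ _)).trans ht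
  rw [div_le_iff₀' (by linarith)] at ht2 ht3
  have hmin : min (ε / 2) ((1 / 2 - θ) / 2) * (t * (‖D‖ ^ 2 + ‖ξ‖ ^ 2) + t ^ 2 * ‖δ‖ ^ 2) ≤
      ε / 2 * (t * (‖D‖ ^ 2 + ‖ξ‖ ^ 2)) + (1 / 2 - θ) / 2 * (t ^ 2 * ‖δ‖ ^ 2) := by
    rw [mul_add]
    gcongr
    · exact min_le_left _ _
    · exact min_le_right _ _
  have := fastEnergy_succ_le_of_coeff hl hc hθ0 hθ hC0 hform h1 h2 h3 h4 h5 h6 h7 h8 h9 h10 h11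
    ht1 ht2 ht3 hD' he he' hmon hmons
  linarith

end Energy

/-- Deterministic Robbins–Siegmund lemma. -/
theorem tendsto_and_summable_of_le_one_add_mul {V w b : ℕ → ℝ} (hV : ∀ k, 0 ≤ V k)
    (hw : ∀ k, 0 ≤ w k) (hb : ∀ k, 0 ≤ b k) (hbs : Summable b)
    (h : ∀ k, V (k + 1) + w k ≤ (1 + b k) * V k) :
    (∃ L, Tendsto V atTop (nhds L)) ∧ Summable w := by
  set S : ℕ → ℝ := fun k => ∑ j ∈ Finset.range k, b j with hS
  have hS_le : ∀ k, S k ≤ ∑' j, b j := fun k => hbs.sum_le_tsum _ fun j _ => hb j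
  have hS_lim : Tendsto S atTop (nhds (∑' j, b j)) := hbs.hasSum.tendsto_sum_nat
  set U : ℕ → ℝ := fun k => Real.exp (-S k) * V k with hU
  have hU0 : ∀ k, 0 ≤ U k := fun k => mul_nonneg (Real.exp_pos _).le (hV k)
  have hstep : ∀ k, U (k + 1) + Real.exp (-S (k + 1)) * w k ≤ U k := by
    intro k
    have hSk : Real.exp (-S (k + 1)) * Real.exp (b k) = Real.exp (-S k) := by
      rw [← Real.exp_add]
      simp only [hS, Finset.sum_range_succ]
      ring_nf
    calc U (k + 1) + Real.exp (-S (k + 1)) * w k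
        = Real.exp (-S (k + 1)) * (V (k + 1) + w k) := by simp only [hU]; ring
      _ ≤ Real.exp (-S (k + 1)) * (Real.exp (b k) * V k) := by
          gcongr
          refine (h k).trans (mul_le_mul_of_nonneg_right ?_ (hV k))
          linarith [Real.add_one_le_exp (b k)]
      _ = U k := by rw [← mul_assoc, hSk]
  have hanti : Antitone U := antitone_nat_of_succ_le fun k =>
    le_trans (le_add_of_nonneg_right (mul_nonneg (Real.exp_pos _).le (hw k))) (hstep k)
  have hUlim := tendsto_atTop_ciInf hanti ⟨0, by rintro _ ⟨k, rfl⟩; exact hU0 k⟩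
  constructor
  · refine ⟨_, ((hS_lim.rexp).mul hUlim).congr fun k => ?_⟩
    simp only [hU]
    rw [← mul_assoc, ← Real.exp_add]
    simp
  · refine summable_of_sum_range_le (c := Real.exp (∑' j, b j) * U 0) hw fun n => ?_
    have hpart : ∀ n, ∑ i ∈ Finset.range n, w i ≤ Real.exp (∑' j, b j) * (U 0 - U n) := by
      intro n
      induction n with
      | zero => simp
      | succ n ih =>
        rw [Finset.sum_range_succ]
        have h1 : w n ≤ Real.exp (∑' j, b j) * (Real.exp (-S (n + 1)) * w n) := by
          rw [← mul_assoc, ← Real.exp_add]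
          refine le_mul_of_one_le_left (hw n) (Real.one_le_exp ?_)
          linarith [hS_le (n + 1)]
        have h2 : Real.exp (∑' j, b j) * (Real.exp (-S (n + 1)) * w n) ≤
            Real.exp (∑' j, b j) * (U n - U (n + 1)) := by
          gcongr
          linarith [hstep n]
        linarith
    refine (hpart n).trans ?_
    gcongr
    linarith [hU0 n]

theorem sq_err_le {H : Type*} [NormedAddCommGroup H] {θ t : ℝ} (hθ : θ < 1 / 2) {δ e : H}
    (he : ‖e‖ ≤ θ * ‖δ‖) :
    t ^ 2 * (1 / 4 * ‖δ‖ ^ 2) ≤ t ^ 2 * (1 / 2 * ‖δ‖ ^ 2 - ‖e‖ ^ 2) := by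
  have h1 : ‖e‖ ≤ 1 / 2 * ‖δ‖ := he.trans (by gcongr)
  have h2 := pow_le_pow_left₀ (norm_nonneg e) h1 2
  gcongr
  linarith

section Dynamics

variable {H : Type*} [NormedAddCommGroup H] [InnerProductSpace ℝ H]

/-- The momentum dynamics of the algorithm, in terms of the displacement `d` from a solution, the
increments `D` of `d`, the operator values `ξ`, the increments `δ` of `ξ`, and the errors `e` such
that `ξ - e` are values of the monotone operator at the iterates. -/
structure FastDynamics (α c θ : ℝ) (d D ξ δ e : ℕ → H) : Prop where
  disp : ∀ k, 2 ≤ k → d (k + 1) - D (k + 1) = d k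
  op : ∀ k, 2 ≤ k → ξ (k + 1) - δ (k + 1) = ξ k
  step : ∀ k : ℕ, 2 ≤ k → (k : ℝ) • D k =
    ((k : ℝ) + α) • D (k + 1) + ((k : ℝ) + α - c) • δ (k + 1) + c • ξ (k + 1)
  err : ∀ k, 2 ≤ k → ‖e k‖ ≤ θ * ‖δ k‖
  mono : ∀ k, 2 ≤ k → 0 ≤ ⟪D (k + 1), δ (k + 1) - e (k + 1) + e k⟫
  mono_sol : ∀ k, 2 ≤ k → 0 ≤ ⟪d k, ξ k - e k⟫

theorem le_fastEnergy {α l t θ : ℝ} (hl : 0 ≤ l) (hθ : θ < 1 / 2)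
    (ht : 0 ≤ t) {d D ξ δ e : H} (he : ‖e‖ ≤ θ * ‖δ‖) (hmons : 0 ≤ ⟪d, ξ - e⟫) :
    2 * l * (α - 1 - l) * ‖d‖ ^ 2 ≤ fastEnergy α l t d D ξ δ e := by
  rw [fastEnergy_eq]
  have h1 : 0 ≤ t ^ 2 * (1 / 4 * ‖δ‖ ^ 2) := by positivity
  have h2 := sq_err_le (t := t) hθ he
  have h3 : 0 ≤ 2 * l * (t * ⟪d, ξ - e⟫) := by positivity
  have h4 := sq_nonneg ‖t • D + l • d + t • e‖
  have h5 := sq_nonneg ‖t • D + t • (ξ - e) + l • d + t • e‖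
  linarith

theorem FastDynamics.fastEnergy_tendsto {α c l θ : ℝ} {d D ξ δ e : ℕ → H}
    (S : FastDynamics α c θ d D ξ δ e) (hl : 0 < l) (hs : 0 < α - 1 - l) (hc : 1 < c)
    (hm : (l + 1 - c - α / 2) ^ 2 < 2 * (α - 1 - l) * (c - 1)) (hθ0 : 0 ≤ θ) (hθ : θ < 1 / 2) :
    (∃ L, Tendsto (fun k : ℕ => fastEnergy α l k (d k) (D k) (ξ k) (δ k) (e k)) atTop (nhds L)) ∧
    Summable (fun k : ℕ => (k : ℝ) * (‖D (k + 1)‖ ^ 2 + ‖ξ (k + 1)‖ ^ 2)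
      + (k : ℝ) ^ 2 * ‖δ (k + 1)‖ ^ 2) := by
  obtain ⟨ε, hε, C, hC, T, hT, hstep⟩ := fastEnergy_succ_le (H := H) hl hs hc hm hθ0 hθ
  set E : ℕ → ℝ := fun k => fastEnergy α l k (d k) (D k) (ξ k) (δ k) (e k) with hE
  set W : ℕ → ℝ := fun k => (k : ℝ) * (‖D (k + 1)‖ ^ 2 + ‖ξ (k + 1)‖ ^ 2)
      + (k : ℝ) ^ 2 * ‖δ (k + 1)‖ ^ 2 with hW
  set R := 2 * l * (α - 1 - l) with hR
  have hR0 : 0 < R := by positivity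
  obtain ⟨N, hN⟩ := exists_nat_ge (max (max T 2) (2 * (C / R)))
  have hlow : ∀ k, 2 ≤ k → R * ‖d k‖ ^ 2 ≤ E k := fun k hk =>
    le_fastEnergy hl.le hθ (Nat.cast_nonneg k) (S.err k hk) (S.mono_sol k hk)
  have hNT : T ≤ N := ((le_max_left _ _).trans (le_max_left _ _)).trans hN
  have hN2 : 2 ≤ N := by exact_mod_cast ((le_max_right _ _).trans (le_max_left _ _)).trans hN
  have hNC : 2 * (C / R) ≤ N := (le_max_right _ _).trans hN
  set b : ℕ → ℝ := fun j => 2 * (C / R / ((j + N : ℕ) : ℝ) ^ 2) with hb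
  have hbs : Summable b := by
    have h0 : Summable fun n : ℕ => 1 / (n : ℝ) ^ 2 := Real.summable_one_div_nat_pow.2 one_lt_two
    have h1 := ((summable_nat_add_iff N).2 h0).mul_left (2 * (C / R))
    refine h1.congr fun j => ?_
    simp only [hb]
    ring
  have key : ∀ j, E (j + 1 + N) + ε * W (j + N) ≤ (1 + b j) * E (j + N) := by
    intro j
    obtain ⟨k, hk⟩ : ∃ k, k = j + N := ⟨_, rfl⟩
    have hkN : (N : ℝ) ≤ k := by rw [hk]; push_cast; linarith [Nat.cast_nonneg (α := ℝ) j]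
    have hk2 : 2 ≤ k := by omega
    have hk1 : (1 : ℝ) ≤ k := hT.trans (hNT.trans hkN)
    have hkey := hstep k (hNT.trans hkN) (d (k + 1)) (D (k + 1)) (ξ (k + 1)) (δ (k + 1))
      (e (k + 1)) (D k) (δ k) (e k) (S.step k hk2) (S.err _ (by omega)) (S.err k hk2)
      (S.mono k hk2) (S.mono_sol _ (by omega))
    rw [S.disp k hk2, S.op k hk2] at hkey
    have hE1 : fastEnergy α l ((k : ℝ) + 1) (d (k + 1)) (D (k + 1)) (ξ (k + 1)) (δ (k + 1))
      (e (k + 1)) = E (k + 1) := by simp only [hE]; push_cast; rfl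
    rw [hE1] at hkey
    set β := C / R / (k : ℝ) ^ 2 with hβ
    have hβ0 : 0 ≤ β := by positivity
    have hβ1 : β ≤ 1 / 2 := by
      rw [hβ, div_le_iff₀ (by positivity)]
      nlinarith
    have hd : C / (k : ℝ) ^ 2 * ‖d (k + 1)‖ ^ 2 ≤ β * E (k + 1) := by
      have := mul_le_mul_of_nonneg_left (hlow (k + 1) (by omega)) hβ0
      refine le_trans (le_of_eq ?_) this
      rw [hβ]
      field_simp
    have hEk : 0 ≤ E (k + 1) := le_trans (by positivity) (hlow (k + 1) (by omega))
    have hWk : 0 ≤ ε * W k := by simp only [hW]; positivity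
    have hmain : (1 - β) * E (k + 1) + ε * W k ≤ E k := by linarith
    have hgoal : E (k + 1) + ε * W k ≤ (1 + 2 * β) * E k := by
      nlinarith [mul_le_mul_of_nonneg_left hmain (by linarith : 0 ≤ 1 + 2 * β),
        mul_nonneg hβ0 hWk, mul_nonneg (mul_nonneg hβ0 (by linarith : 0 ≤ 1 - 2 * β)) hEk]
    have e1 : j + 1 + N = k + 1 := by omega
    rw [e1]
    simp only [hb]
    rw [← hk]
    exact hgoal
  have hres := tendsto_and_summable_of_le_one_add_mul (V := fun j => E (j + N))
    (w := fun j => ε * W (j + N)) (b := b)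
    (fun j => le_trans (by positivity) (hlow (j + N) (by omega)))
    (fun j => by simp only [hW]; positivity) (fun j => by simp only [hb]; positivity) hbs key
  obtain ⟨⟨L, hL⟩, hsum⟩ := hres
  refine ⟨⟨L, (tendsto_add_atTop_iff_nat N).1 hL⟩, (summable_nat_add_iff N).1 ?_⟩
  exact (summable_mul_left_iff hε.ne').1 hsum

theorem fastEnergy_zero_le {α t θ : ℝ} (hθ : θ < 1 / 2) {d D ξ δ e : H}
    (he : ‖e‖ ≤ θ * ‖δ‖) :
    fastEnergy α 0 t d D ξ δ e ≤ 4 * (t ^ 2 * (‖D‖ ^ 2 + ‖ξ‖ ^ 2 + ‖δ‖ ^ 2)) := by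
  unfold fastEnergy
  have h1 : ‖e‖ ≤ 1 / 2 * ‖δ‖ := he.trans (by gcongr)
  have h2 := pow_le_pow_left₀ (norm_nonneg e) h1 2
  have h3 : ‖t • D + t • ξ‖ ^ 2 + ‖t • D - t • ξ‖ ^ 2 = 2 * (‖t • D‖ ^ 2 + ‖t • ξ‖ ^ 2) := by
    linarith [parallelogram_law_with_norm ℝ (t • D) (t • ξ)]
  have h4 := sq_nonneg ‖t • D - t • ξ‖
  have h5 := norm_sub_sq_real (t • D) (t • e)
  have h6 := sq_nonneg ‖t • D - t • e‖
  have hs : ∀ z : H, ‖t • z‖ ^ 2 = t ^ 2 * ‖z‖ ^ 2 := fun z => by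
    rw [norm_smul, mul_pow, Real.norm_eq_abs, sq_abs]
  rw [hs] at *
  have h7 := mul_le_mul_of_nonneg_left h2 (sq_nonneg t)
  have h8 : 0 ≤ t ^ 2 * ‖ξ‖ ^ 2 := by positivity
  have h9 : 0 ≤ t ^ 2 * ‖δ‖ ^ 2 := by positivity
  rw [hs] at *
  linarith

theorem FastDynamics.fastEnergy_zero_tendsto {α c θ : ℝ} {d D ξ δ e : ℕ → H}
    (S : FastDynamics α c θ d D ξ δ e) (hcl : 1 < c) (hcu : c < α - 1)
    (hθ0 : 0 ≤ θ) (hθ : θ < 1 / 2) :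
    Tendsto (fun k : ℕ => fastEnergy α 0 k (d k) (D k) (ξ k) (δ k) (e k)) atTop (nhds 0) := by
  have hr : 0 < (c - 1) * (α - 1 - c) := mul_pos (by linarith) (by linarith)
  set τ := min (1 / 2) ((c - 1) * (α - 1 - c)) with hτ
  have hτ0 : 0 < τ := lt_min (by norm_num) hr
  have hτ1 : τ ≤ 1 / 2 := min_le_left _ _
  have hτ2 : τ ≤ (c - 1) * (α - 1 - c) := min_le_right _ _
  obtain ⟨⟨L₁, h₁⟩, hsum⟩ := S.fastEnergy_tendsto (l := α / 2) (by linarith) (by linarith) hcl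
    (by nlinarith) hθ0 hθ
  obtain ⟨⟨L₂, h₂⟩, -⟩ := S.fastEnergy_tendsto (l := α / 2 - τ) (by linarith) (by linarith) hcl
    (by nlinarith) hθ0 hθ
  have h0 := (((h₂.const_mul (α / 2)).sub (h₁.const_mul (α / 2 - τ))).div_const τ).congr
    (f₂ := fun k : ℕ => fastEnergy α 0 k (d k) (D k) (ξ k) (δ k) (e k)) fun k => by
      unfold fastEnergy
      field_simp
      ring
  set ℓ := (α / 2 * L₂ - (α / 2 - τ) * L₁) / τ
  have hnonneg : 0 ≤ ℓ := ge_of_tendsto h0 <| by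
    filter_upwards [eventually_ge_atTop 2] with k hk
    have := le_fastEnergy (α := α) (D := D k) le_rfl hθ (Nat.cast_nonneg k) (S.err k hk)
      (S.mono_sol k hk)
    simpa using this
  rcases hnonneg.eq_or_lt with hz | hpos
  · rwa [← hz] at h0
  exfalso
  have hev : ∀ᶠ k : ℕ in atTop,
      ‖1 / ((k + 1 : ℕ) : ℝ)‖ ≤ (16 / ℓ) * ((k : ℝ) * (‖D (k + 1)‖ ^ 2 + ‖ξ (k + 1)‖ ^ 2)
      + (k : ℝ) ^ 2 * ‖δ (k + 1)‖ ^ 2) := by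
    have := ((tendsto_add_atTop_iff_nat 1).2 h0).eventually (lt_mem_nhds (half_lt_self hpos))
    filter_upwards [this, eventually_ge_atTop 2] with k hk hk2
    have hup := fastEnergy_zero_le (α := α) (t := ((k + 1 : ℕ) : ℝ)) (d := d (k + 1))
      (D := D (k + 1)) (ξ := ξ (k + 1)) hθ (S.err (k + 1) (by omega))
    have hlt := hk.trans_le hup
    have hk1 : (1 : ℝ) ≤ k := by exact_mod_cast (by omega : 1 ≤ k)
    rw [Real.norm_of_nonneg (by positivity), div_le_iff₀ (by positivity)]
    push_cast at hlt ⊢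
    set Q := ‖D (k + 1)‖ ^ 2 + ‖ξ (k + 1)‖ ^ 2
    set N := ‖δ (k + 1)‖ ^ 2
    have hQ : 0 ≤ Q := by positivity
    have hN : 0 ≤ N := by positivity
    have h3 : ((k : ℝ) + 1) * (Q + N) ≤ 2 * ((k : ℝ) * Q + (k : ℝ) ^ 2 * N) := by
      nlinarith [mul_nonneg hQ (by linarith : (0 : ℝ) ≤ k - 1),
        mul_nonneg hN (by nlinarith : (0 : ℝ) ≤ 2 * (k : ℝ) ^ 2 - k - 1)]
    have h4 : ℓ / 2 ≤ 8 * (((k : ℝ) + 1) * ((k : ℝ) * Q + (k : ℝ) ^ 2 * N)) := by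
      nlinarith [mul_le_mul_of_nonneg_left h3 (by linarith : (0 : ℝ) ≤ k + 1)]
    rw [div_mul_eq_mul_div, div_mul_eq_mul_div, le_div_iff₀ hpos]
    linarith
  have hs : Summable fun k : ℕ => 1 / ((k + 1 : ℕ) : ℝ) :=
    Summable.of_norm_bounded_eventually_nat (hsum.mul_left (16 / ℓ)) hev
  exact Real.not_summable_one_div_natCast
    ((summable_nat_add_iff (f := fun n : ℕ => 1 / (n : ℝ)) 1).1 hs)

theorem FastDynamics.rates {α c θ : ℝ} {d D ξ δ e : ℕ → H}
    (S : FastDynamics α c θ d D ξ δ e) (hcl : 1 < c) (hcu : c < α - 1)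
    (hθ0 : 0 ≤ θ) (hθ : θ < 1 / 2) :
    Tendsto (fun k : ℕ => (k : ℝ) * ‖D k‖) atTop (nhds 0) ∧
    Tendsto (fun k : ℕ => (k : ℝ) * ‖ξ k - e k‖) atTop (nhds 0) ∧
    ∃ B, ∀ᶠ k in atTop, ‖d k‖ ≤ B := by
  have h0 := S.fastEnergy_zero_tendsto hcl hcu hθ0 hθ
  have hroot := h0.sqrt
  rw [Real.sqrt_zero] at hroot
  set r : ℕ → ℝ := fun k => √(fastEnergy α 0 k (d k) (D k) (ξ k) (δ k) (e k)) with hr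
  have hbd : ∀ k : ℕ, 2 ≤ k → (k : ℝ) * ‖e k‖ ≤ r k ∧ ‖(k : ℝ) • D k + (k : ℝ) • e k‖ ≤ r k ∧
      ‖(k : ℝ) • D k + (k : ℝ) • ξ k‖ ≤ r k := by
    intro k hk
    have h1 : 0 ≤ (k : ℝ) ^ 2 * (1 / 4 * ‖δ k‖ ^ 2) := by positivity
    have h2 := sq_err_le (t := k) hθ (S.err k hk)
    have h3 : ‖e k‖ ≤ 1 / 2 * ‖δ k‖ := (S.err k hk).trans (by gcongr)
    have h4 := mul_le_mul_of_nonneg_left (pow_le_pow_left₀ (norm_nonneg _) h3 2)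
      (sq_nonneg (k : ℝ))
    have heq := fastEnergy_eq α 0 k (d k) (D k) (ξ k) (δ k) (e k)
    have hv : (k : ℝ) • D k + (k : ℝ) • (ξ k - e k) + (0 : ℝ) • d k + (k : ℝ) • e k =
      (k : ℝ) • D k + (k : ℝ) • ξ k := by module
    rw [hv, zero_smul, add_zero] at heq
    have h5 := sq_nonneg ‖(k : ℝ) • D k + (k : ℝ) • e k‖
    have h6 := sq_nonneg ‖(k : ℝ) • D k + (k : ℝ) • ξ k‖
    refine ⟨Real.le_sqrt_of_sq_le ?_, Real.le_sqrt_of_sq_le ?_, Real.le_sqrt_of_sq_le ?_⟩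
    · rw [mul_pow]; linarith
    · linarith
    · linarith
  have hn : ∀ (k : ℕ) (z : H), (k : ℝ) * ‖z‖ = ‖(k : ℝ) • z‖ := fun k z => by
    rw [norm_smul, Real.norm_natCast]
  have hD : ∀ k : ℕ, 2 ≤ k → (k : ℝ) * ‖D k‖ ≤ 2 * r k := by
    intro k hk
    obtain ⟨h1, h2, -⟩ := hbd k hk
    rw [hn] at h1 ⊢
    have := norm_sub_le ((k : ℝ) • D k + (k : ℝ) • e k) ((k : ℝ) • e k)
    rw [add_sub_cancel_right] at this
    linarith
  refine ⟨?_, ?_, ?_⟩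
  · refine squeeze_zero' (Eventually.of_forall fun k => by positivity)
      ((eventually_ge_atTop 2).mono hD) ?_
    simpa using hroot.const_mul 2
  · refine squeeze_zero' (g := fun k => 4 * r k) (Eventually.of_forall fun k => by positivity)
      ((eventually_ge_atTop 2).mono fun k hk => ?_) (by simpa using hroot.const_mul 4)
    obtain ⟨h1, -, h3⟩ := hbd k hk
    have h2 := hD k hk
    rw [hn] at h1 h2 ⊢
    have e1 : (k : ℝ) • (ξ k - e k) =
      (k : ℝ) • D k + (k : ℝ) • ξ k - (k : ℝ) • D k - (k : ℝ) • e k := by module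
    rw [e1]
    have h4 := norm_sub_le ((k : ℝ) • D k + (k : ℝ) • ξ k - (k : ℝ) • D k) ((k : ℝ) • e k)
    have h5 := norm_sub_le ((k : ℝ) • D k + (k : ℝ) • ξ k) ((k : ℝ) • D k)
    linarith
  · obtain ⟨⟨L, hL⟩, -⟩ := S.fastEnergy_tendsto (l := α / 2) (by linarith) (by linarith) hcl
      (by nlinarith) hθ0 hθ
    have hR : 0 < 2 * (α / 2) * (α - 1 - α / 2) := mul_pos (by linarith) (by linarith)
    refine ⟨√((L + 1) / (2 * (α / 2) * (α - 1 - α / 2))), ?_⟩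
    filter_upwards [hL.eventually (gt_mem_nhds (lt_add_one L)), eventually_ge_atTop 2]
      with k hk hk2
    refine Real.le_sqrt_of_sq_le ?_
    rw [le_div_iff₀' hR]
    exact (le_fastEnergy (by linarith) hθ (Nat.cast_nonneg k) (S.err k hk2)
      (S.mono_sol k hk2)).trans hk.le

end Dynamics

theorem ConvexOn.add_inner_gradient_le {X : Type*} [NormedAddCommGroup X] [InnerProductSpace ℝ X]
    [CompleteSpace X] {h : X → ℝ} (hh : ConvexOn ℝ Set.univ h) {g a : X}
    (hg : HasGradientAt h g a) (b : X) : h a + ⟪g, b - a⟫ ≤ h b := by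
  have hline : ConvexOn ℝ Set.univ (h ∘ AffineMap.lineMap (k := ℝ) a b) := by
    simpa using hh.comp_affineMap (AffineMap.lineMap (k := ℝ) a b)
  have hderiv : HasDerivAt (h ∘ AffineMap.lineMap (k := ℝ) a b) ⟪g, b - a⟫ 0 := by
    have h1 : HasFDerivAt h (InnerProductSpace.toDual ℝ X g)
        (AffineMap.lineMap (k := ℝ) a b 0) := by
      simpa using hg.hasFDerivAt
    have h2 := h1.comp_hasDerivAt (0 : ℝ) (AffineMap.hasDerivAt_lineMap (a := a) (b := b))
    simpa using h2
  have := hline.le_slope_of_hasDerivAt (Set.mem_univ 0) (Set.mem_univ 1) one_pos hderiv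
  rw [slope_def_field] at this
  simp only [Function.comp_apply, AffineMap.lineMap_apply_one, AffineMap.lineMap_apply_zero,
    sub_zero, div_one] at this
  linarith

theorem momentum_step {E : Type*} [AddCommGroup E] [Module ℝ E] {α c t : ℝ} (ht : t + α ≠ 0)
    {z z₀ z₁ y y₀ : E}
    (hy : y = z + (1 - α / (t + α)) • (z - z₀) + (1 - c / (t + α)) • (y₀ - z)) :
    t • (z - z₀) = (t + α) • (z₁ - z) + (t + α - c) • (y - z₁ - (y₀ - z)) + c • (y - z₁) := by
  subst hy
  match_scalars <;> field_simp <;> ring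

theorem norm_sq_primalDual_sub_le {X Y : Type*} [NormedAddCommGroup X] [InnerProductSpace ℝ X]
    [CompleteSpace X] [NormedAddCommGroup Y] [InnerProductSpace ℝ Y] [CompleteSpace Y]
    (A : X →L[ℝ] Y) {L : ℝ} (hL : 0 ≤ L) {p q x y : X} (hpq : ‖p - q‖ ≤ L * ‖x - y‖) (μ ν : Y) :
    ‖p - q + ContinuousLinearMap.adjoint A (μ - ν)‖ ^ 2 + ‖A (x - y)‖ ^ 2 ≤
      ((L + ‖A‖) ^ 2 + ‖A‖ ^ 2) * (‖x - y‖ ^ 2 + ‖μ - ν‖ ^ 2) := by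
  have h1 : ‖ContinuousLinearMap.adjoint A (μ - ν)‖ ≤ ‖A‖ * ‖μ - ν‖ := by
    simpa using (ContinuousLinearMap.adjoint A).le_opNorm (μ - ν)
  have h2 := A.le_opNorm (x - y)
  have h3 := (norm_add_le (p - q) (ContinuousLinearMap.adjoint A (μ - ν))).trans
    (add_le_add hpq h1)
  have h4 := pow_le_pow_left₀ (norm_nonneg _) h3 2
  have h5 := pow_le_pow_left₀ (norm_nonneg _) h2 2
  have hN := norm_nonneg A
  generalize ‖A‖ = N at *
  generalize ‖x - y‖ = s at *
  generalize ‖μ - ν‖ = t at *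
  have h6 : 0 ≤ L * N * ((s - t) ^ 2 + s ^ 2 + t ^ 2) := by positivity
  have h7 : 0 ≤ (L * t) ^ 2 + (N * s) ^ 2 + (N * t) ^ 2 := by positivity
  nlinarith

theorem inner_saddle_sub_nonneg {X Y : Type*} [NormedAddCommGroup X] [InnerProductSpace ℝ X]
    [CompleteSpace X] [NormedAddCommGroup Y] [InnerProductSpace ℝ Y] [CompleteSpace Y]
    (A : X →L[ℝ] Y) (b : Y) {x₁ x₂ u₁ u₂ g₁ g₂ : X} {l₁ l₂ v₁ v₂ : Y}
    (hu : 0 ≤ ⟪x₁ - x₂, u₁ - u₂⟫) (hg : 0 ≤ ⟪x₁ - x₂, g₁ - g₂⟫) (hv : 0 ≤ ⟪l₁ - l₂, v₁ - v₂⟫) :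
    0 ≤ ⟪x₁ - x₂, (u₁ + g₁ + ContinuousLinearMap.adjoint A l₁) -
        (u₂ + g₂ + ContinuousLinearMap.adjoint A l₂)⟫ +
      ⟪l₁ - l₂, (v₁ - A x₁ + b) - (v₂ - A x₂ + b)⟫ := by
  have e1 : (u₁ + g₁ + ContinuousLinearMap.adjoint A l₁) -
      (u₂ + g₂ + ContinuousLinearMap.adjoint A l₂) =
      (u₁ - u₂) + (g₁ - g₂) + ContinuousLinearMap.adjoint A (l₁ - l₂) := by
    rw [map_sub]; abel
  have e2 : (v₁ - A x₁ + b) - (v₂ - A x₂ + b) = (v₁ - v₂) - A (x₁ - x₂) := by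
    rw [map_sub]; abel
  rw [e1, e2, inner_add_right, inner_add_right,
    inner_sub_right (l₁ - l₂) (v₁ - v₂), ContinuousLinearMap.adjoint_inner_right,
    real_inner_comm (l₁ - l₂)]
  linarith

theorem abs_gap_le_of_residual {X Y : Type*} [NormedAddCommGroup X] [InnerProductSpace ℝ X]
    [CompleteSpace X] [NormedAddCommGroup Y] [InnerProductSpace ℝ Y] [CompleteSpace Y]
    {K : Set Y} {f h : X → ℝ} (hh : ConvexOn ℝ Set.univ h) {A : X →L[ℝ] Y} {b : Y}
    {x u g : X} {l v : Y} (hg : HasGradientAt h g x)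
    (hsub : ∀ x', f x + ⟪u, x' - x⟫ ≤ f x') (hl : ∀ ζ ∈ K, 0 ≤ ⟪l, ζ⟫)
    (hv : ∀ μ : Y, (∀ ζ ∈ K, 0 ≤ ⟪μ, ζ⟫) → ⟪v, μ - l⟫ ≤ 0)
    {xs gs : X} {ls : Y} (hgs : HasGradientAt h gs xs) (hls : ∀ ζ ∈ K, 0 ≤ ⟪ls, ζ⟫)
    (hfeas : A xs - b ∈ -K) (hcomp : ⟪ls, A xs - b⟫ = 0)
    (hsubs : ∀ x', f xs + ⟪-gs - ContinuousLinearMap.adjoint A ls, x' - xs⟫ ≤ f x') {M : ℝ}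
    (hM : ‖x - xs‖ + ‖l - ls‖ + ‖ls‖ ≤ M) :
    |(f x + h x + ⟪ls, A x - b⟫) - (f xs + h xs + ⟪l, A xs - b⟫)| ≤
        M * (‖u + g + ContinuousLinearMap.adjoint A l‖ + ‖v - A x + b‖) ∧
      |⟪l, A x - b⟫| ≤ M * (‖u + g + ContinuousLinearMap.adjoint A l‖ + ‖v - A x + b‖) ∧
      |f x + h x - f xs - h xs| ≤
        M * (‖u + g + ContinuousLinearMap.adjoint A l‖ + ‖v - A x + b‖) := by
  set η := u + g + ContinuousLinearMap.adjoint A l with hη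
  set ζ := v - A x + b with hζ
  have hvl : ⟪v, l⟫ = 0 := by
    have h1 := hv 0 (by simp)
    have h2 := hv ((2 : ℝ) • l) fun ζ hζ => by
      rw [real_inner_smul_left]
      exact mul_nonneg two_pos.le (hl ζ hζ)
    rw [two_smul, add_sub_cancel_right] at h2
    rw [zero_sub, inner_neg_right] at h1
    linarith
  have hvls : ⟪v, ls⟫ ≤ 0 := by
    have := hv ls hls
    rw [inner_sub_right] at this
    linarith
  have hlfeas : ⟪l, A xs - b⟫ ≤ 0 := by
    have := hl _ (Set.mem_neg.1 hfeas)
    rw [inner_neg_right] at this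
    linarith
  have hAx : A x - b = v - ζ := by rw [hζ]; abel
  have hlA : ⟪l, A x - b⟫ = -⟪l, ζ⟫ := by
    rw [hAx, inner_sub_right, real_inner_comm, hvl, zero_sub]
  have hlsA : ⟪ls, A x - b⟫ ≤ -⟪ls, ζ⟫ := by
    rw [hAx, inner_sub_right, real_inner_comm]
    linarith
  have hup : f x + h x - f xs - h xs ≤ ⟪η, x - xs⟫ + ⟪l, ζ⟫ + ⟪l, A xs - b⟫ := by
    have h1 := hsub xs
    have h2 := hh.add_inner_gradient_le hg xs
    have h3 : ⟪η, x - xs⟫ = -⟪u, xs - x⟫ - ⟪g, xs - x⟫ + (⟪l, A x - b⟫ - ⟪l, A xs - b⟫) := by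
      rw [hη, inner_add_left, inner_add_left, ContinuousLinearMap.adjoint_inner_left,
        ← inner_sub_right, ← neg_sub x xs, inner_neg_right, inner_neg_right, map_sub,
        sub_sub_sub_cancel_right]
      ring
    linarith
  have hlow : 0 ≤ f x + h x - f xs - h xs + ⟪ls, A x - b⟫ := by
    have h1 := hsubs x
    have h2 := hh.add_inner_gradient_le hgs x
    have h3 : ⟪-gs - ContinuousLinearMap.adjoint A ls, x - xs⟫ =
        -⟪gs, x - xs⟫ - (⟪ls, A x - b⟫ - ⟪ls, A xs - b⟫) := by
      rw [inner_sub_left, inner_neg_left, ContinuousLinearMap.adjoint_inner_left,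
        ← inner_sub_right, map_sub, sub_sub_sub_cancel_right]
    linarith
  have b1 := abs_le.1 (abs_real_inner_le_norm η (x - xs))
  have b2 := abs_le.1 (abs_real_inner_le_norm (l - ls) ζ)
  have b3 := abs_le.1 (abs_real_inner_le_norm ls ζ)
  have e1 : ⟪l, ζ⟫ = ⟪l - ls, ζ⟫ + ⟪ls, ζ⟫ := by rw [inner_sub_left]; ring
  have p1 := mul_nonneg (norm_nonneg η) (norm_nonneg (x - xs))
  have p2 := mul_nonneg (norm_nonneg η) (norm_nonneg (l - ls))
  have p3 := mul_nonneg (norm_nonneg η) (norm_nonneg ls)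
  have p4 := mul_nonneg (norm_nonneg ζ) (norm_nonneg (x - xs))
  have p5 := mul_nonneg (norm_nonneg (l - ls)) (norm_nonneg ζ)
  have p6 := mul_nonneg (norm_nonneg ls) (norm_nonneg ζ)
  have hMm := mul_le_mul_of_nonneg_right hM (add_nonneg (norm_nonneg η) (norm_nonneg ζ))
  have hexp : (‖x - xs‖ + ‖l - ls‖ + ‖ls‖) * (‖η‖ + ‖ζ‖) = ‖η‖ * ‖x - xs‖ + ‖η‖ * ‖l - ls‖ +
    ‖η‖ * ‖ls‖ + ‖ζ‖ * ‖x - xs‖ + ‖l - ls‖ * ‖ζ‖ + ‖ls‖ * ‖ζ‖ := by ring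
  refine ⟨abs_le.2 ⟨?_, ?_⟩, abs_le.2 ⟨?_, ?_⟩, abs_le.2 ⟨?_, ?_⟩⟩ <;> linarith

theorem stmt_14
    {X : Type*} [NormedAddCommGroup X] [InnerProductSpace ℝ X] [CompleteSpace X]
    {Y : Type*} [NormedAddCommGroup Y] [InnerProductSpace ℝ Y] [CompleteSpace Y]
    (K : Set Y) (hKne : K.Nonempty) (hKcl : IsClosed K) (hKcvx : Convex ℝ K)
    (hKcone : ∀ t : ℝ, 0 ≤ t → ∀ ζ ∈ K, t • ζ ∈ K)
    (f : X → ℝ) (hf : ConvexOn ℝ Set.univ f) (hflsc : LowerSemicontinuous f)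
    (h : X → ℝ) (h' : X → X)
    (hh : ConvexOn ℝ Set.univ h) (hh' : ∀ a : X, HasGradientAt h (h' a) a)
    (Lh : ℝ) (hLh : 0 ≤ Lh) (hh'lip : ∀ a b : X, ‖h' a - h' b‖ ≤ Lh * ‖a - b‖)
    (A : X →L[ℝ] Y) (b : Y) (α c γ : ℝ)
    (hα : 2 < α) (hcl : α / 2 < c) (hcu : c < α - 1)
    (hγ0 : 0 < γ) (hγ : γ < 1 / (2 * Real.sqrt ((Lh + ‖A‖) ^ 2 + ‖A‖ ^ 2)))
    (x y1 w1 : ℕ → X) (lam y2 w2 : ℕ → Y) (u : ℕ → X) (v : ℕ → Y)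
    (hy1 : ∀ k : ℕ, 1 ≤ k → y1 k = x k + (1 - α / ((k : ℝ) + α)) • (x k - x (k - 1))
        + (1 - c / ((k : ℝ) + α)) • (y1 (k - 1) - x k))
    (hy2 : ∀ k : ℕ, 1 ≤ k → y2 k = lam k + (1 - α / ((k : ℝ) + α)) • (lam k - lam (k - 1))
        + (1 - c / ((k : ℝ) + α)) • (y2 (k - 1) - lam k))
    (hw1 : ∀ k : ℕ, 1 ≤ k → w1 k = y1 k - (y1 (k - 1) - x k))
    (hw2 : ∀ k : ℕ, 1 ≤ k → w2 k = y2 k - (y2 (k - 1) - lam k))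
    (hu : ∀ k : ℕ, u (k + 1) = γ⁻¹ • (y1 k - x (k + 1)) - h' (w1 k)
        - (ContinuousLinearMap.adjoint A) (w2 k))
    (husub : ∀ k : ℕ, ∀ x' : X, f (x (k + 1)) + ⟪u (k + 1), x' - x (k + 1)⟫ ≤ f x')
    (hlamK : ∀ k : ℕ, ∀ ζ ∈ K, 0 ≤ ⟪lam (k + 1), ζ⟫)
    (hvdef : ∀ k : ℕ, v (k + 1) = γ⁻¹ • (y2 k - lam (k + 1)) + A (w1 k) - b)
    (hvnc : ∀ k : ℕ, ∀ μ : Y, (∀ ζ ∈ K, 0 ≤ ⟪μ, ζ⟫) → ⟪v (k + 1), μ - lam (k + 1)⟫ ≤ 0)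
    (xs : X) (ls : Y)
    (hsol : (∀ ζ ∈ K, 0 ≤ ⟪ls, ζ⟫) ∧ A xs - b ∈ -K ∧ ⟪ls, A xs - b⟫ = 0 ∧
      (∀ x' : X, f xs + ⟪-h' xs - (ContinuousLinearMap.adjoint A) ls, x' - xs⟫ ≤ f x')) :
    Tendsto (fun k : ℕ => (k : ℝ) * ‖x k - x (k - 1)‖) atTop (nhds 0) ∧
    Tendsto (fun k : ℕ => (k : ℝ) * ‖lam k - lam (k - 1)‖) atTop (nhds 0) ∧
    Tendsto (fun k : ℕ =>
      (k : ℝ) * ‖u k + h' (x k) + (ContinuousLinearMap.adjoint A) (lam k)‖) atTop (nhds 0) ∧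
    Tendsto (fun k : ℕ => (k : ℝ) * ‖v k - A (x k) + b‖) atTop (nhds 0) ∧
    Tendsto (fun k : ℕ => (k : ℝ) *
      ((f (x k) + h (x k) + ⟪ls, A (x k) - b⟫) - (f xs + h xs + ⟪lam k, A xs - b⟫))) atTop (nhds 0) ∧
    Tendsto (fun k : ℕ => (k : ℝ) * |⟪lam k, A (x k) - b⟫|) atTop (nhds 0) ∧
    Tendsto (fun k : ℕ => (k : ℝ) * |f (x k) + h (x k) - f xs - h xs|) atTop (nhds 0) := by
  obtain ⟨hls, hfeas, hcomp, hsubs⟩ := hsol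
  set A' := ContinuousLinearMap.adjoint A with hA'
  set L := √((Lh + ‖A‖) ^ 2 + ‖A‖ ^ 2) with hL
  have hL0 : 0 ≤ L := Real.sqrt_nonneg _
  have hLsq : L ^ 2 = (Lh + ‖A‖) ^ 2 + ‖A‖ ^ 2 := Real.sq_sqrt (by positivity)
  have hθ : γ * L < 1 / 2 := by
    rcases hL0.eq_or_lt with h0 | h0
    · rw [← h0]; norm_num
    · rw [lt_div_iff₀ (by positivity)] at hγ
      linarith
  set z : ℕ → WithLp 2 (X × Y) := fun k => WithLp.toLp 2 (x k, lam k) with hz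
  set y : ℕ → WithLp 2 (X × Y) := fun k => WithLp.toLp 2 (y1 k, y2 k) with hy
  set zs : WithLp 2 (X × Y) := WithLp.toLp 2 (xs, ls) with hzs
  set r : ℕ → X := fun k => u k + h' (x k) + A' (lam k) with hr
  set s : ℕ → Y := fun k => v k - A (x k) + b with hs
  set G : ℕ → WithLp 2 (X × Y) := fun k => WithLp.toLp 2 (γ • r k, γ • s k) with hG
  have hyz : ∀ k : ℕ, 1 ≤ k → y k = z k + (1 - α / ((k : ℝ) + α)) • (z k - z (k - 1))
      + (1 - c / ((k : ℝ) + α)) • (y (k - 1) - z k) := fun k hk => by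
    simp only [hy, hz, ← WithLp.toLp_sub, ← WithLp.toLp_smul, ← WithLp.toLp_add, Prod.mk_sub_mk,
      Prod.smul_mk, Prod.mk_add_mk, ← hy1 k hk, ← hy2 k hk]
  have hmono : ∀ (x₁ u₁ x₂ u₂ : X) (l₁ v₁ l₂ v₂ : Y), 0 ≤ ⟪x₁ - x₂, u₁ - u₂⟫ →
      0 ≤ ⟪l₁ - l₂, v₁ - v₂⟫ →
      0 ≤ ⟪(WithLp.toLp 2 (x₁, l₁) - WithLp.toLp 2 (x₂, l₂) : WithLp 2 (X × Y)),
        WithLp.toLp 2 (γ • (u₁ + h' x₁ + A' l₁), γ • (v₁ - A x₁ + b)) -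
        WithLp.toLp 2 (γ • (u₂ + h' x₂ + A' l₂), γ • (v₂ - A x₂ + b))⟫ := by
    intro x₁ u₁ x₂ u₂ l₁ v₁ l₂ v₂ hu hv
    have hg : 0 ≤ ⟪x₁ - x₂, h' x₁ - h' x₂⟫ := by
      have h1 := hh.add_inner_gradient_le (hh' x₁) x₂
      have h2 := hh.add_inner_gradient_le (hh' x₂) x₁
      rw [real_inner_comm, inner_sub_left]
      rw [← neg_sub x₁ x₂, inner_neg_right] at h1
      linarith
    have := mul_nonneg hγ0.le (inner_saddle_sub_nonneg A b hu hg hv)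
    rw [← WithLp.toLp_sub, ← WithLp.toLp_sub, WithLp.prod_inner_apply]
    simp only [Prod.mk_sub_mk, ← smul_sub, real_inner_smul_right]
    rwa [← mul_add]
  have S : FastDynamics α c (γ * L) (fun k => z k - zs) (fun k => z k - z (k - 1))
      (fun k => y (k - 1) - z k) (fun k => y (k - 1) - z k - (y (k - 1 - 1) - z (k - 1)))
      (fun k => y (k - 1) - z k - G k) := by
    refine ⟨fun k _ => ?_, fun k _ => ?_, fun k hk => ?_, fun k hk => ?_, fun k hk => ?_,
      fun k hk => ?_⟩
    · simp
    · simp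
    · have hkα : (k : ℝ) + α ≠ 0 := by positivity
      simpa using momentum_step hkα (hyz k (by omega)) (z₁ := z (k + 1))
    · obtain ⟨j, rfl⟩ : ∃ j, k = j + 1 := ⟨k - 1, by omega⟩
      have hj : 1 ≤ j := by omega
      have e1 : y j - z (j + 1) - (y (j - 1) - z j) =
          WithLp.toLp 2 (w1 j - x (j + 1), w2 j - lam (j + 1)) := by
        simp only [hy, hz, ← WithLp.toLp_sub, Prod.mk_sub_mk, hw1 j hj, hw2 j hj]
        congr 2 <;> abel
      have e2 : y j - z (j + 1) - G (j + 1) = WithLp.toLp 2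
          (γ • (h' (w1 j) - h' (x (j + 1)) + A' (w2 j - lam (j + 1))),
            -(γ • A (w1 j - x (j + 1)))) := by
        simp only [hy, hz, hG, hr, hs, ← WithLp.toLp_sub, Prod.mk_sub_mk, hu j, hvdef j, map_sub]
        congr 2
        · match_scalars <;> field_simp <;> ring
        · match_scalars <;> field_simp <;> ring
      simp only [Nat.add_sub_cancel]
      rw [e1, e2]
      refine (sq_le_sq₀ (norm_nonneg _) (by positivity)).1 ?_
      rw [mul_pow, WithLp.prod_norm_sq_eq_of_L2, WithLp.prod_norm_sq_eq_of_L2, mul_pow, hLsq]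
      simp only [WithLp.toLp_fst, WithLp.toLp_snd, norm_neg, norm_smul, mul_pow,
        Real.norm_eq_abs, sq_abs]
      have := mul_le_mul_of_nonneg_left (norm_sq_primalDual_sub_le A hLh
        (hh'lip (w1 j) (x (j + 1))) (w2 j) (lam (j + 1))) (sq_nonneg γ)
      linarith
    · obtain ⟨j, rfl⟩ : ∃ j, k = j + 1 := ⟨k - 1, by omega⟩
      have hm := hmono (x (j + 1 + 1)) (u (j + 1 + 1)) (x (j + 1)) (u (j + 1)) (lam (j + 1 + 1))
        (v (j + 1 + 1)) (lam (j + 1)) (v (j + 1)) ?_ ?_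
      · convert hm using 2
        · rfl
        · change _ = G (j + 1 + 1) - G (j + 1)
          simp only [Nat.add_sub_cancel]
          abel
      · have h1 := husub (j + 1) (x (j + 1))
        have h2 := husub j (x (j + 1 + 1))
        rw [← neg_sub (x (j + 1 + 1)), inner_neg_right] at h1
        rw [real_inner_comm, inner_sub_left]
        linarith
      · have h1 := hvnc (j + 1) _ (hlamK j)
        have h2 := hvnc j _ (hlamK (j + 1))
        rw [← neg_sub (lam (j + 1 + 1)), inner_neg_right] at h1
        rw [real_inner_comm, inner_sub_left]
        linarith
    · obtain ⟨j, rfl⟩ : ∃ j, k = j + 1 := ⟨k - 1, by omega⟩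
      have hm := hmono (x (j + 1)) (u (j + 1)) xs (-h' xs - A' ls) (lam (j + 1))
        (v (j + 1)) ls (A xs - b) ?_ ?_
      · have e1 : -h' xs - A' ls + h' xs + A' ls = 0 := by abel
        have e2 : A xs - b - A xs + b = 0 := by abel
        rw [e1, e2, smul_zero, smul_zero] at hm
        convert hm using 2
        change _ = G (j + 1) - 0
        rw [sub_sub_cancel, sub_zero]
      · have h1 := husub j xs
        have h2 := hsubs (x (j + 1))
        rw [← neg_sub (x (j + 1)), inner_neg_right] at h1
        rw [real_inner_comm, inner_sub_left]
        linarith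
      · have h1 := hvnc j ls hls
        have h2 := hlamK j _ (Set.mem_neg.1 hfeas)
        rw [← neg_sub (lam (j + 1)), inner_neg_right] at h1
        rw [inner_neg_right] at h2
        rw [inner_sub_right, real_inner_comm, inner_sub_left, hcomp]
        linarith
  obtain ⟨hD, hR, B, hB⟩ := S.rates (by linarith) hcu (by positivity) hθ
  simp only [sub_sub_cancel] at hR
  have hcomp1 : ∀ a : WithLp 2 (X × Y), ‖a.fst‖ ≤ ‖a‖ := fun a => WithLp.norm_fst_le _ a
  have hcomp2 : ∀ a : WithLp 2 (X × Y), ‖a.snd‖ ≤ ‖a‖ := fun a => WithLp.norm_snd_le _ a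
  have hr0 : Tendsto (fun k : ℕ => (k : ℝ) * ‖r k‖) atTop (nhds 0) := by
    refine squeeze_zero (fun k => by positivity) (fun k => ?_)
      (by simpa using hR.const_mul γ⁻¹)
    have h1 := hcomp1 (G k)
    have h2 : ‖(G k).fst‖ = γ * ‖r k‖ := by
      simp [hG, norm_smul, abs_of_pos hγ0]
    rw [h2] at h1
    rw [mul_left_comm]
    gcongr
    rwa [le_inv_mul_iff₀ hγ0]
  have hs0 : Tendsto (fun k : ℕ => (k : ℝ) * ‖s k‖) atTop (nhds 0) := by
    refine squeeze_zero (fun k => by positivity) (fun k => ?_)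
      (by simpa using hR.const_mul γ⁻¹)
    have h1 := hcomp2 (G k)
    have h2 : ‖(G k).snd‖ = γ * ‖s k‖ := by
      simp [hG, norm_smul, abs_of_pos hγ0]
    rw [h2] at h1
    rw [mul_left_comm]
    gcongr
    rwa [le_inv_mul_iff₀ hγ0]
  set M := B + B + ‖ls‖ with hM
  have hgap : ∀ᶠ k : ℕ in atTop,
      |(f (x k) + h (x k) + ⟪ls, A (x k) - b⟫) - (f xs + h xs + ⟪lam k, A xs - b⟫)| ≤
        M * (‖r k‖ + ‖s k‖) ∧ |⟪lam k, A (x k) - b⟫| ≤ M * (‖r k‖ + ‖s k‖) ∧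
      |f (x k) + h (x k) - f xs - h xs| ≤ M * (‖r k‖ + ‖s k‖) := by
    filter_upwards [hB, eventually_ge_atTop 1] with k hk hk1
    obtain ⟨j, rfl⟩ : ∃ j, k = j + 1 := ⟨k - 1, by omega⟩
    refine abs_gap_le_of_residual hh (hh' _) (husub j) (hlamK j) (hvnc j) (hh' xs) hls hfeas
      hcomp hsubs ?_
    have h1 : ‖x (j + 1) - xs‖ ≤ B := (hcomp1 _).trans hk
    have h2 : ‖lam (j + 1) - ls‖ ≤ B := (hcomp2 _).trans hk
    linarith
  have hM0 : Tendsto (fun k : ℕ => (k : ℝ) * (M * (‖r k‖ + ‖s k‖))) atTop (nhds 0) := by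
    have := (hr0.add hs0).const_mul M
    rw [add_zero, mul_zero] at this
    exact this.congr fun k => by ring
  refine ⟨squeeze_zero (fun k => by positivity) (fun k => ?_) hD,
    squeeze_zero (fun k => by positivity) (fun k => ?_) hD, hr0, hs0,
    squeeze_zero_norm' (hgap.mono fun k hk => ?_) hM0,
    squeeze_zero' (Eventually.of_forall fun k => by positivity) (hgap.mono fun k hk => ?_) hM0,
    squeeze_zero' (Eventually.of_forall fun k => by positivity) (hgap.mono fun k hk => ?_) hM0⟩
  · exact mul_le_mul_of_nonneg_left (hcomp1 (z k - z (k - 1))) (Nat.cast_nonneg k)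
  · exact mul_le_mul_of_nonneg_left (hcomp2 (z k - z (k - 1))) (Nat.cast_nonneg k)
  · rw [norm_mul, Real.norm_natCast]
    exact mul_le_mul_of_nonneg_left hk.1 (Nat.cast_nonneg k)
  · exact mul_le_mul_of_nonneg_left hk.2.1 (Nat.cast_nonneg k)
  · exact mul_le_mul_of_nonneg_left hk.2.2 (Nat.cast_nonneg k)
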